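/- arXiv:2601.18175 — 2 statements merged into one kernel-verified Lean document; each statement's English description precedes it below -/
import Mathlib

section
/- π₊ is a probability mass function on A (it is nonnegative and sums to 1), and the following three quantities are equal: (i) the relative advantage (Σ_a π₊(a)·Adv(a))/V; (ii) the chi-squared divergence χ²(π₊‖π0); (iii) the action-influence I. -/
/-- **Triple identity at a single state.**
Single-state setup: `π0` is a strictly positive pmf on a finite nonempty action
type `A`, `Q : A → ℝ` takes values in `[0,1]`, `V = Σ_a π0(a)·Q(a) > 0`,
`Adv(a) = Q(a) − V`, the success-conditioned policy is `π₊(a) = π0(a)·Q(a)/V`,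
the action-influence is `I = Σ_a π0(a)·(Adv(a)/V)²`, and
`χ²(π‖π0) = Σ_a π0(a)·(π(a)/π0(a) − 1)²`.

Then `π₊` is a probability mass function, and the relative advantage
`(Σ_a π₊(a)·Adv(a))/V`, the chi-squared divergence `χ²(π₊‖π0)`, and the
action-influence `I` are all equal. -/
theorem success_conditioning_triple_identity
    {A : Type*} [Fintype A] [Nonempty A]
    (π0 : A → ℝ) (hπ0pos : ∀ a, 0 < π0 a) (hπ0sum : ∑ a, π0 a = 1)
    (Q : A → ℝ) (hQ : ∀ a, 0 ≤ Q a ∧ Q a ≤ 1)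
    (V : ℝ) (hV : V = ∑ a, π0 a * Q a) (hVpos : 0 < V)
    (Adv : A → ℝ) (hAdv : ∀ a, Adv a = Q a - V)
    (πp : A → ℝ) (hπp : ∀ a, πp a = π0 a * Q a / V)
    (I : ℝ) (hI : I = ∑ a, π0 a * (Adv a / V) ^ 2) :
    ((∀ a, 0 ≤ πp a) ∧ ∑ a, πp a = 1)
      ∧ (∑ a, πp a * Adv a) / V = ∑ a, π0 a * (πp a / π0 a - 1) ^ 2
      ∧ ∑ a, π0 a * (πp a / π0 a - 1) ^ 2 = I := by
  have chi : ∑ a, π0 a * (πp a / π0 a - 1) ^ 2 = I := by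
    rw [hI]
    refine Finset.sum_congr rfl fun a _ => ?_
    have hπ0 := (hπ0pos a).ne'
    rw [hπp, hAdv]
    field_simp
  have mean_adv : ∑ a, π0 a * Adv a = 0 := by
    simp only [hAdv, mul_sub, Finset.sum_sub_distrib, ← Finset.sum_mul, hπ0sum, ← hV]
    ring
  have adv : (∑ a, πp a * Adv a) / V = I := by
    have split : ∀ a, πp a * Adv a / V = π0 a * (Adv a / V) ^ 2 + π0 a * Adv a / V := by
      intro a
      rw [hπp, hAdv]
      field_simp
      ring
    rw [Finset.sum_div, Finset.sum_congr rfl fun a _ => split a, Finset.sum_add_distrib,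
      ← Finset.sum_div, mean_adv, zero_div, add_zero, hI]
  refine ⟨⟨fun a => ?_, ?_⟩, adv.trans chi.symm, chi⟩
  · rw [hπp]
    exact div_nonneg (mul_nonneg (hπ0pos a).le (hQ a).1) hVpos.le
  · simp only [hπp]
    rw [← Finset.sum_div, ← hV, div_self hVpos.ne']
end

section
/- Excess cross-entropy equals occupancy-weighted KL: let π̂ be a Markov policy with π̂(a|s) > 0 whenever π₊(a|s) > 0, assume ρ(π0) > 0, that d⁺_{π0}(s) < ∞ for every nonterminal s, and that ℓ(π̂) and ℓ(π₊) are finite, where ℓ(π) := 𝔼_{π0,μ}[ −Σ_{t < T} log π(Aₜ|Xₜ) | ∃ t, Xₜ ∈ 𝒯₊ ] and T is the (almost surely finite) first hitting time of 𝒯. Then ℓ(π̂) − ℓ(π₊) = Σ_{s nonterminal} d⁺_{π0}(s)·KL(π₊(·|s) ‖ π̂(·|s)), where KL(p‖q) := Σ_a p(a)·log(p(a)/q(a)) with the convention 0·log 0 = 0. -/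
open MeasureTheory
open scoped ENNReal

/-- A pmf on a finite type, as a real-valued function. -/
def IsPMFOn {α : Type*} [Fintype α] (p : α → ℝ) : Prop :=
  (∀ x, 0 ≤ p x) ∧ ∑ x, p x = 1

/-- A terminated trajectory of an episodic MDP: the initial state together with the
list of (action, next-state) steps, recorded up to the first visit to a terminal
state.  Under almost-sure termination this is a faithful (countable) sample space
for the Ionescu–Tulcea law of the chain, terminal states being absorbing. -/
structure Traj (S A : Type*) where
  init : S
  steps : List (A × S)

instance {S A : Type*} : MeasurableSpace (Traj S A) := ⊤

variable {S A : Type*}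

/-- The last recorded state of a trajectory. -/
def lastState (ω : Traj S A) : S := ω.steps.foldl (fun _ p => p.2) ω.init

/-- The state `Xₜ` at time `t` (after termination the chain is absorbed, so we
return the last recorded state). -/
def stateAt (ω : Traj S A) (t : ℕ) : S :=
  (ω.init :: ω.steps.map Prod.snd).getD t (lastState ω)

/-- The action `Aₜ` at time `t`, defined (as `some a`) for `t` before the
termination time. -/
def actionAt (ω : Traj S A) (t : ℕ) : Option A := ω.steps[t]?.map Prod.fst

/-- Probability weight of a path started at `s`: the product of the policy and
transition probabilities along the path, the path being required to stop exactly
on first reaching the terminal set `Term`. -/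
def pathWeight [DecidableEq S] (Term : Finset S) (P : S → A → S → ℝ)
    (π : S → A → ℝ) : S → List (A × S) → ℝ
  | s, [] => if s ∈ Term then 1 else 0
  | s, (a, s') :: l =>
      if s ∈ Term then 0 else π s a * P s a s' * pathWeight Term P π s' l

/-- The law `ℙ_{π,μ}` of the episodic chain `X₀ ~ μ, Aₜ ~ π(·|Xₜ),
X_{t+1} ~ P(·|Xₜ,Aₜ)` with terminal set `Term`, as a measure on terminated
trajectories.  When the chain reaches `Term` almost surely this is a probability
measure and is the (pushforward of the) Ionescu–Tulcea trajectory law. -/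
noncomputable def trajMeasure [DecidableEq S] (Term : Finset S) (P : S → A → S → ℝ)
    (π : S → A → ℝ) (μ : S → ℝ) : Measure (Traj S A) :=
  Measure.sum fun ω : Traj S A =>
    ENNReal.ofReal (μ ω.init * pathWeight Term P π ω.init ω.steps) • Measure.dirac ω

/-- The success event `{∃ t, Xₜ ∈ 𝒯₊}`. -/
def SuccessEvent (Tp : Finset S) : Set (Traj S A) := {ω | ∃ t, stateAt ω t ∈ Tp}

/-- The point mass at `s`, as an initial distribution. -/
def pointMass [DecidableEq S] (s : S) : S → ℝ := fun s' => if s' = s then 1 else 0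

/-- The value `V_π(s) := ℙ_{π,s}(∃ t, Xₜ ∈ 𝒯₊)`. -/
noncomputable def Vval [DecidableEq S] (Term Tp : Finset S) (P : S → A → S → ℝ)
    (π : S → A → ℝ) (s : S) : ℝ :=
  (trajMeasure Term P π (pointMass s) (SuccessEvent Tp)).toReal

/-- The Q-value `Q_π(s,a) := Σ_{s'} P(s'|s,a)·V_π(s')`. -/
noncomputable def Qval [Fintype S] [DecidableEq S] (Term Tp : Finset S)
    (P : S → A → S → ℝ) (π : S → A → ℝ) (s : S) (a : A) : ℝ :=
  ∑ s', P s a s' * Vval Term Tp P π s'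

/-- The success-conditioned policy `π₊(a|s) := π0(a|s)·Q_{π0}(s,a)/V_{π0}(s)`. -/
noncomputable def piPlus [Fintype S] [DecidableEq S] (Term Tp : Finset S)
    (P : S → A → S → ℝ) (π0 : S → A → ℝ) : S → A → ℝ :=
  fun s a => π0 s a * Qval Term Tp P π0 s a / Vval Term Tp P π0 s

/-- The action-influence
`I(s) := Σ_a π0(a|s)·((Q_{π0}(s,a) − V_{π0}(s))/V_{π0}(s))²`. -/
noncomputable def influence [Fintype S] [DecidableEq S] [Fintype A] (Term Tp : Finset S)
    (P : S → A → S → ℝ) (π0 : S → A → ℝ) (s : S) : ℝ :=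
  ∑ a, π0 s a * ((Qval Term Tp P π0 s a - Vval Term Tp P π0 s)
      / Vval Term Tp P π0 s) ^ 2

/-- The occupancy measure `d_π(s) := Σ_{t≥0} ℙ_{π,μ}(Xₜ = s)` (in `ℝ≥0∞`). -/
noncomputable def dOcc [DecidableEq S] (Term : Finset S) (P : S → A → S → ℝ)
    (π : S → A → ℝ) (μ : S → ℝ) (s : S) : ℝ≥0∞ :=
  ∑' t : ℕ, trajMeasure Term P π μ {ω | stateAt ω t = s}

/-- The success-conditioned occupancy
`d⁺_π(s) := 𝔼_{π,μ}[Σ_{t≥0} 1(Xₜ = s) | ∃ t, Xₜ ∈ 𝒯₊]` (in `ℝ≥0∞`). -/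
noncomputable def dPlusOcc [DecidableEq S] (Term Tp : Finset S) (P : S → A → S → ℝ)
    (π : S → A → ℝ) (μ : S → ℝ) (s : S) : ℝ≥0∞ :=
  ∫⁻ ω, (∑' t : ℕ, if stateAt ω t = s then 1 else 0)
    ∂ (ProbabilityTheory.cond (trajMeasure Term P π μ) (SuccessEvent Tp))

/-- Log-likelihood `Σ_{t<T} log π(Aₜ|Xₜ)` of the recorded path under policy `π`. -/
noncomputable def pathLogLik (π : S → A → ℝ) : S → List (A × S) → ℝ
  | _, [] => 0
  | s, (a, s') :: l => Real.log (π s a) + pathLogLik π s' l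

/-- The cross-entropy loss
`ℓ(π) := 𝔼_{π0,μ}[ −Σ_{t<T} log π(Aₜ|Xₜ) | ∃ t, Xₜ ∈ 𝒯₊ ]`. -/
noncomputable def xent [DecidableEq S] (Term Tp : Finset S) (P : S → A → S → ℝ)
    (π0 : S → A → ℝ) (μ : S → ℝ) (π : S → A → ℝ) : ℝ :=
  ∫ ω, -(pathLogLik π ω.init ω.steps)
    ∂ (ProbabilityTheory.cond (trajMeasure Term P π0 μ) (SuccessEvent Tp))

section TrajectorySums

open ProbabilityTheory

theorem tsum_traj [Fintype S] (f : S → List (A × S) → ℝ≥0∞) :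
    ∑' ω : Traj S A, f ω.init ω.steps = ∑ s, ∑' l, f s l := by
  let e : S × List (A × S) ≃ Traj S A :=
    ⟨fun p => ⟨p.1, p.2⟩, fun ω => (ω.init, ω.steps), fun _ => rfl, fun _ => rfl⟩
  rw [← e.tsum_eq, ← tsum_fintype (L := .unconditional _), ← ENNReal.tsum_prod]
  rfl

theorem tsum_steps [Fintype S] [Fintype A] (f : List (A × S) → ℝ≥0∞) :
    ∑' l, f l = f [] + ∑ a, ∑ s, ∑' l, f ((a, s) :: l) := by
  let e : Unit ⊕ (A × S) × List (A × S) ≃ List (A × S) :=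
    { toFun := Sum.elim (fun _ => []) fun p => p.1 :: p.2
      invFun := fun l => match l with
        | [] => Sum.inl ()
        | x :: l => Sum.inr (x, l)
      left_inv := by rintro (_ | _) <;> rfl
      right_inv := by rintro (_ | _) <;> rfl }
  rw [← e.tsum_eq, Summable.tsum_sum ENNReal.summable ENNReal.summable,
    ENNReal.tsum_prod (f := fun p l => f (e (Sum.inr (p, l)))),
    tsum_fintype, tsum_fintype, Fintype.sum_prod_type, Fintype.sum_unique]
  rfl

theorem measurable_of_traj {β : Type*} [MeasurableSpace β] (f : Traj S A → β) : Measurable f :=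
  fun _ _ => trivial

variable [DecidableEq S] (T Tp : Finset S) (P : S → A → S → ℝ) (π : S → A → ℝ) (μ : S → ℝ)

/-- The weight of a path, set to zero unless the path is successful. -/
noncomputable def successWeight (s : S) (l : List (A × S)) : ℝ≥0∞ :=
  (SuccessEvent Tp).indicator (fun ω => ENNReal.ofReal (pathWeight T P π ω.init ω.steps)) ⟨s, l⟩

theorem lintegral_trajMeasure (f : Traj S A → ℝ≥0∞) :
    ∫⁻ ω, f ω ∂trajMeasure T P π μ
      = ∑' ω : Traj S A, ENNReal.ofReal (μ ω.init * pathWeight T P π ω.init ω.steps) * f ω := by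
  unfold trajMeasure
  rw [lintegral_sum_measure]
  refine tsum_congr fun ω => ?_
  rw [lintegral_smul_measure, lintegral_dirac' _ (measurable_of_traj f), smul_eq_mul]

theorem setLIntegral_trajMeasure [Fintype S] (hμ : ∀ s, 0 ≤ μ s)
    (f : S → List (A × S) → ℝ≥0∞) :
    ∫⁻ ω in SuccessEvent Tp, f ω.init ω.steps ∂trajMeasure T P π μ
      = ∑ s, ENNReal.ofReal (μ s) * ∑' l, successWeight T Tp P π s l * f s l := by
  classical
  rw [← lintegral_indicator (by trivial), lintegral_trajMeasure]
  simp_rw [← ENNReal.tsum_mul_left]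
  rw [← tsum_traj]
  refine tsum_congr fun ω => ?_
  rw [ENNReal.ofReal_mul (hμ _), mul_assoc]
  congr 1
  by_cases h : ω ∈ SuccessEvent Tp <;> simp [successWeight, h]

theorem lintegral_cond_trajMeasure [Fintype S] (hμ : ∀ s, 0 ≤ μ s)
    (f : S → List (A × S) → ℝ≥0∞) :
    ∫⁻ ω, f ω.init ω.steps ∂(trajMeasure T P π μ)[|SuccessEvent Tp]
      = (trajMeasure T P π μ (SuccessEvent Tp))⁻¹
        * ∑ s, ENNReal.ofReal (μ s) * ∑' l, successWeight T Tp P π s l * f s l := by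
  rw [ProbabilityTheory.cond, lintegral_smul_measure, smul_eq_mul,
    setLIntegral_trajMeasure T Tp P π μ hμ]

theorem lintegral_cond_eq_tsum [Fintype S] (hμ : ∀ s, 0 ≤ μ s)
    (f : ℕ → S → List (A × S) → ℝ≥0∞) :
    ∫⁻ ω, ∑' t, f t ω.init ω.steps ∂(trajMeasure T P π μ)[|SuccessEvent Tp]
      = (trajMeasure T P π μ (SuccessEvent Tp))⁻¹
        * ∑ s, ENNReal.ofReal (μ s) * ∑' t, ∑' l, successWeight T Tp P π s l * f t s l := by
  rw [lintegral_cond_trajMeasure T Tp P π μ hμ fun s l => ∑' t, f t s l]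
  simp_rw [← ENNReal.tsum_mul_left]
  congr! 3
  rw [ENNReal.tsum_comm]

theorem trajMeasure_pointMass_success [Fintype S] (s : S) :
    trajMeasure T P π (pointMass s) (SuccessEvent Tp) = ∑' l, successWeight T Tp P π s l := by
  have hμ : ∀ x, 0 ≤ pointMass s x := fun x => by unfold pointMass; split_ifs <;> simp
  have h := setLIntegral_trajMeasure T Tp P π (pointMass s) hμ fun _ _ => 1
  rw [setLIntegral_one] at h
  rw [h, Finset.sum_eq_single s] <;> simp +contextual [pointMass]

theorem successWeight_cons (hsub : Tp ⊆ T) (hπ : ∀ s ∉ T, ∀ a, 0 ≤ π s a)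
    (hP : ∀ s a s', 0 ≤ P s a s') (s : S) (a : A) (s' : S) (l : List (A × S)) :
    successWeight T Tp P π s ((a, s') :: l)
      = if s ∈ T then 0 else
          ENNReal.ofReal (π s a) * (ENNReal.ofReal (P s a s') * successWeight T Tp P π s' l) := by
  classical
  by_cases hs : s ∈ T
  · simp [successWeight, pathWeight, hs, Set.indicator]
  · have hsp : s ∉ Tp := fun h => hs (hsub h)
    have hiff : (⟨s, (a, s') :: l⟩ : Traj S A) ∈ SuccessEvent Tp
        ↔ (⟨s', l⟩ : Traj S A) ∈ SuccessEvent Tp := by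
      constructor
      · rintro ⟨t | t, ht⟩
        · exact absurd ht hsp
        · exact ⟨t, ht⟩
      · rintro ⟨t, ht⟩
        exact ⟨t + 1, ht⟩
    by_cases h : (⟨s', l⟩ : Traj S A) ∈ SuccessEvent Tp
    · simp only [successWeight, Set.indicator, hiff, h, pathWeight, hs, if_true, if_false]
      rw [mul_assoc, ENNReal.ofReal_mul (hπ s hs a), ENNReal.ofReal_mul (hP s a s')]
    · simp [successWeight, Set.indicator, hiff, h, hs]

/-- First-step decomposition of a sum over successful paths. -/
theorem tsum_successWeight_mul [Fintype S] [Fintype A] (hsub : Tp ⊆ T)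
    (hπ : ∀ s ∉ T, ∀ a, 0 ≤ π s a) (hP : ∀ s a s', 0 ≤ P s a s') (s : S)
    (f : List (A × S) → ℝ≥0∞) :
    ∑' l, successWeight T Tp P π s l * f l
      = successWeight T Tp P π s [] * f [] + if s ∈ T then 0 else
          ∑ a, ENNReal.ofReal (π s a) * ∑ s', ENNReal.ofReal (P s a s') *
            ∑' l, successWeight T Tp P π s' l * f ((a, s') :: l) := by
  rw [tsum_steps]
  simp_rw [successWeight_cons T Tp P π hsub hπ hP]
  split_ifs
  · simp
  · simp_rw [Finset.mul_sum, mul_assoc, ENNReal.tsum_mul_left]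

theorem successWeight_nil_of_notMem {s : S} (hs : s ∉ T) :
    successWeight T Tp P π s [] = 0 := by
  classical
  simp [successWeight, Set.indicator, pathWeight, hs]

end TrajectorySums

section Counting

open ProbabilityTheory

variable [DecidableEq S] [DecidableEq A]

/-- Indicator that the step taken at time `t` of a path leaves state `s` with action `a`. -/
def stepIndicator (s : S) (a : A) : ℕ → S → List (A × S) → ℝ≥0∞
  | _, _, [] => 0
  | 0, x, (b, _) :: _ => if x = s ∧ b = a then 1 else 0
  | t + 1, _, (_, y) :: l => stepIndicator s a t y l

/-- Number of steps of a path that leave state `s` with action `a`. -/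
def stepCount (s : S) (a : A) : S → List (A × S) → ℕ
  | _, [] => 0
  | x, (b, y) :: l => (if x = s ∧ b = a then 1 else 0) + stepCount s a y l

theorem tsum_stepIndicator (s : S) (a : A) (x : S) (l : List (A × S)) :
    ∑' t, stepIndicator s a t x l = stepCount s a x l := by
  induction l generalizing x with
  | nil => simp [stepIndicator, stepCount]
  | cons p l ih =>
    rw [tsum_eq_zero_add' ENNReal.summable]
    simp [stepIndicator, stepCount, ih]

theorem pathLogLik_eq_sum [Fintype S] [Fintype A] (π : S → A → ℝ) (x : S) (l : List (A × S)) :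
    pathLogLik π x l = ∑ s, ∑ a, (stepCount s a x l : ℝ) * Real.log (π s a) := by
  induction l generalizing x with
  | nil => simp [pathLogLik, stepCount]
  | cons p l ih =>
    simp only [pathLogLik, stepCount, ih, Nat.cast_add, add_mul, Finset.sum_add_distrib]
    congr 1
    simp [ite_and]

variable [Fintype S] [Fintype A] (T Tp : Finset S) (P : S → A → S → ℝ) (π : S → A → ℝ)

/-- On successful paths, the action taken at a visit to `s` is distributed as `piPlus`. -/
theorem tsum_successWeight_stepIndicator (hsub : Tp ⊆ T)
    (hπ : ∀ s ∉ T, ∀ a, 0 ≤ π s a) (hP : ∀ s a s', 0 ≤ P s a s')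
    (hfin : ∀ s, ∑' l, successWeight T Tp P π s l ≠ ⊤)
    (hV : ∀ s ∉ T, 0 < Vval T Tp P π s) {s : S} (hs : s ∉ T) (a : A) (t : ℕ) (x : S) :
    ∑' l, successWeight T Tp P π x l * stepIndicator s a t x l
      = ENNReal.ofReal (piPlus T Tp P π s a)
        * ∑' l, successWeight T Tp P π x l * (if stateAt ⟨x, l⟩ t = s then 1 else 0) := by
  have hval : ∀ y, ∑' l, successWeight T Tp P π y l = ENNReal.ofReal (Vval T Tp P π y) := by
    intro y
    rw [Vval, trajMeasure_pointMass_success, ENNReal.ofReal_toReal (hfin y)]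
  induction t generalizing x with
  | zero =>
    rw [tsum_successWeight_mul T Tp P π hsub hπ hP]
    by_cases hx : x = s
    · subst hx
      have hst : ∀ l : List (A × S), stateAt ⟨x, l⟩ 0 = x := fun _ => rfl
      simp only [stepIndicator, hst, if_true, mul_one, hs, if_false, mul_zero, zero_add, true_and]
      rw [Finset.sum_eq_single a (by intro b _ hb; simp [hb]) (by simp)]
      simp only [if_true, mul_one, hval]
      have hV0 : ∀ y, 0 ≤ Vval T Tp P π y := fun y => ENNReal.toReal_nonneg
      simp_rw [← ENNReal.ofReal_mul (hP _ _ _)]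
      rw [← ENNReal.ofReal_sum_of_nonneg fun y _ => mul_nonneg (hP _ _ _) (hV0 _),
        ← ENNReal.ofReal_mul (hπ x hs a), ← ENNReal.ofReal_mul' (hV0 x)]
      congr 1
      rw [piPlus, div_mul_cancel₀ _ (hV x hs).ne', Qval]
    · have hst : ∀ l : List (A × S), stateAt ⟨x, l⟩ 0 = x := fun _ => rfl
      simp [stepIndicator, hst, hx]
  | succ t ih =>
    rw [tsum_successWeight_mul T Tp P π hsub hπ hP, tsum_successWeight_mul T Tp P π hsub hπ hP]
    have hst : ∀ b y (l : List (A × S)), stateAt ⟨x, (b, y) :: l⟩ (t + 1) = stateAt ⟨y, l⟩ t :=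
      fun _ _ _ => rfl
    have hnil : stateAt (⟨x, []⟩ : Traj S A) (t + 1) = x := rfl
    simp only [stepIndicator, hst, hnil, ih, mul_zero, zero_add]
    by_cases hx : x ∈ T
    · have hxs : x ≠ s := fun h => hs (h ▸ hx)
      simp [hx, hxs]
    · simp only [hx, if_false, successWeight_nil_of_notMem T Tp P π hx, zero_mul, zero_add,
        Finset.mul_sum]
      refine Finset.sum_congr rfl fun b _ => Finset.sum_congr rfl fun y _ => ?_
      ring

theorem tsum_successWeight_stepIndicator_of_mem (hsub : Tp ⊆ T)
    (hπ : ∀ s ∉ T, ∀ a, 0 ≤ π s a) (hP : ∀ s a s', 0 ≤ P s a s') {s : S} (hs : s ∈ T) (a : A)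
    (t : ℕ) (x : S) :
    ∑' l, successWeight T Tp P π x l * stepIndicator s a t x l = 0 := by
  induction t generalizing x with
  | zero =>
    rw [tsum_successWeight_mul T Tp P π hsub hπ hP]
    by_cases hx : x = s
    · subst hx
      simp [stepIndicator, hs]
    · simp [stepIndicator, hx]
  | succ t ih =>
    rw [tsum_successWeight_mul T Tp P π hsub hπ hP]
    simp [stepIndicator, ih]

/-- The success-conditioned expected number of steps leaving `s` with action `a`. -/
theorem lintegral_stepCount (hsub : Tp ⊆ T)
    (hπ : ∀ s ∉ T, ∀ a, 0 ≤ π s a) (hP : ∀ s a s', 0 ≤ P s a s')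
    (hfin : ∀ s, ∑' l, successWeight T Tp P π s l ≠ ⊤)
    (hV : ∀ s ∉ T, 0 < Vval T Tp P π s) (μ : S → ℝ) (hμ : ∀ s, 0 ≤ μ s) (s : S) (a : A) :
    ∫⁻ ω, (stepCount s a ω.init ω.steps : ℝ≥0∞) ∂(trajMeasure T P π μ)[|SuccessEvent Tp]
      = if s ∈ T then 0 else
          ENNReal.ofReal (piPlus T Tp P π s a) * dPlusOcc T Tp P π μ s := by
  simp_rw [← tsum_stepIndicator]
  rw [lintegral_cond_eq_tsum T Tp P π μ hμ]
  split_ifs with hs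
  · simp [tsum_successWeight_stepIndicator_of_mem T Tp P π hsub hπ hP hs]
  · have h := lintegral_cond_eq_tsum T Tp P π μ hμ
      fun t x l => if stateAt ⟨x, l⟩ t = s then 1 else 0
    rw [dPlusOcc, h]
    simp_rw [tsum_successWeight_stepIndicator T Tp P π hsub hπ hP hfin hV hs a,
      ENNReal.tsum_mul_left, Finset.mul_sum]
    refine Finset.sum_congr rfl fun x _ => ?_
    ring

/-- The cross-entropy loss in terms of the success-conditioned occupancy. -/
theorem xent_eq_sum (hsub : Tp ⊆ T)
    (hπ : ∀ s ∉ T, ∀ a, 0 ≤ π s a) (hP : ∀ s a s', 0 ≤ P s a s')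
    (hfin : ∀ s, ∑' l, successWeight T Tp P π s l ≠ ⊤)
    (hV : ∀ s ∉ T, 0 < Vval T Tp P π s) (μ : S → ℝ) (hμ : ∀ s, 0 ≤ μ s)
    (hd : ∀ s ∉ T, dPlusOcc T Tp P π μ s ≠ ⊤)
    (hplus : ∀ s ∉ T, ∀ a, 0 ≤ piPlus T Tp P π s a) (π' : S → A → ℝ) :
    xent T Tp P π μ π'
      = -∑ s ∈ Tᶜ, (dPlusOcc T Tp P π μ s).toReal
          * ∑ a, piPlus T Tp P π s a * Real.log (π' s a) := by
  have hlint := lintegral_stepCount T Tp P π hsub hπ hP hfin hV μ hμ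
  have hne : ∀ s a, ∫⁻ ω, (stepCount s a ω.init ω.steps : ℝ≥0∞)
      ∂(trajMeasure T P π μ)[|SuccessEvent Tp] ≠ ⊤ := by
    intro s a
    rw [hlint]
    split_ifs with hs
    · simp
    · exact ENNReal.mul_ne_top ENNReal.ofReal_ne_top (hd s hs)
  have hint : ∀ s a, Integrable (fun ω : Traj S A => (stepCount s a ω.init ω.steps : ℝ))
      (trajMeasure T P π μ)[|SuccessEvent Tp] := by
    intro s a
    simpa using integrable_toReal_of_lintegral_ne_top
      (measurable_of_traj _).aemeasurable (hne s a)
  have hval : ∀ s a, ∫ ω, (stepCount s a ω.init ω.steps : ℝ)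
      ∂(trajMeasure T P π μ)[|SuccessEvent Tp]
      = if s ∈ T then 0 else (dPlusOcc T Tp P π μ s).toReal * piPlus T Tp P π s a := by
    intro s a
    have h := integral_toReal (μ := (trajMeasure T P π μ)[|SuccessEvent Tp])
      (f := fun ω : Traj S A => (stepCount s a ω.init ω.steps : ℝ≥0∞))
      (measurable_of_traj _).aemeasurable (by simp)
    simp only [ENNReal.toReal_natCast] at h
    rw [h, hlint]
    split_ifs with hs
    · simp
    · rw [ENNReal.toReal_mul, ENNReal.toReal_ofReal (hplus s hs a), mul_comm]
  rw [xent, integral_neg]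
  simp_rw [pathLogLik_eq_sum]
  rw [integral_finsetSum _ fun s _ => integrable_finsetSum _ fun a _ => (hint s a).mul_const _]
  congr 1
  rw [← Finset.sum_subset (Finset.subset_univ Tᶜ)]
  · refine Finset.sum_congr rfl fun s hs => ?_
    rw [integral_finsetSum _ fun a _ => (hint s a).mul_const _, Finset.mul_sum]
    refine Finset.sum_congr rfl fun a _ => ?_
    rw [integral_mul_const, hval, if_neg (Finset.mem_compl.mp hs), mul_assoc]
  · intro s _ hs
    rw [integral_finsetSum _ fun a _ => (hint s a).mul_const _]
    refine Finset.sum_eq_zero fun a _ => ?_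
    rw [integral_mul_const, hval, if_pos (by simpa using hs), zero_mul]

end Counting

/-- **Excess cross-entropy equals occupancy-weighted KL.**
Episodic-MDP setup: `S` finite with terminal set `𝒯 = 𝒯₊ ∪ 𝒯₋` (disjoint), `A`
finite nonempty, transition kernel `P` (a pmf in its last argument) absorbing on
`𝒯`, every Markov policy reaching `𝒯` almost surely from every state, behavior
policy `π0` with `V_{π0}(s) > 0` at every nonterminal `s`, and initial
distribution `μ` supported on nonterminal states.

Let `π̂` be a Markov policy with `π̂(a|s) > 0` whenever `π₊(a|s) > 0`; assume
`ρ(π0) > 0`, that `d⁺_{π0}(s) < ∞` for every nonterminal `s`, and that `ℓ(π̂)`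
and `ℓ(π₊)` are finite (integrable), where
`ℓ(π) := 𝔼_{π0,μ}[ −Σ_{t<T} log π(Aₜ|Xₜ) | ∃ t, Xₜ ∈ 𝒯₊ ]`. Then
`ℓ(π̂) − ℓ(π₊) = Σ_{s nonterminal} d⁺_{π0}(s)·KL(π₊(·|s) ‖ π̂(·|s))`, where
`KL(p‖q) = Σ_a p(a)·log(p(a)/q(a))` (with the convention `0·log 0 = 0`,
automatic since `Real.log 0 = 0`). -/
theorem excess_cross_entropy_eq_weighted_KL
    {S A : Type*} [Fintype S] [DecidableEq S] [Fintype A] [Nonempty A]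
    (T Tp Tm : Finset S) (hpart : Tp ∪ Tm = T) (hdisj : Disjoint Tp Tm)
    (P : S → A → S → ℝ) (hP : ∀ s a, IsPMFOn (P s a))
    (habs : ∀ s ∈ T, ∀ a, P s a s = 1)
    (hterm : ∀ π : S → A → ℝ, (∀ s ∉ T, IsPMFOn (π s)) →
      ∀ s : S, trajMeasure T P π (pointMass s) Set.univ = 1)
    (π0 : S → A → ℝ) (hπ0 : ∀ s ∉ T, IsPMFOn (π0 s))
    (hV0 : ∀ s ∉ T, 0 < Vval T Tp P π0 s)
    (μ : S → ℝ) (hμ : IsPMFOn μ) (hμT : ∀ s ∈ T, μ s = 0)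
    (πh : S → A → ℝ) (hπh : ∀ s ∉ T, IsPMFOn (πh s))
    (hsupp : ∀ s ∉ T, ∀ a, 0 < piPlus T Tp P π0 s a → 0 < πh s a)
    (hρ0 : 0 < trajMeasure T P π0 μ (SuccessEvent Tp))
    (hdp : ∀ s ∉ T, dPlusOcc T Tp P π0 μ s ≠ ⊤)
    (hint1 : Integrable (fun ω : Traj S A => -(pathLogLik πh ω.init ω.steps))
      (ProbabilityTheory.cond (trajMeasure T P π0 μ) (SuccessEvent Tp)))
    (hint2 : Integrable
      (fun ω : Traj S A => -(pathLogLik (piPlus T Tp P π0) ω.init ω.steps))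
      (ProbabilityTheory.cond (trajMeasure T P π0 μ) (SuccessEvent Tp))) :
    xent T Tp P π0 μ πh - xent T Tp P π0 μ (piPlus T Tp P π0)
      = ∑ s ∈ Tᶜ, (dPlusOcc T Tp P π0 μ s).toReal
          * ∑ a, piPlus T Tp P π0 s a
              * Real.log (piPlus T Tp P π0 s a / πh s a) := by
  classical
  have hsub : Tp ⊆ T := hpart ▸ Finset.subset_union_left
  have hπ : ∀ s ∉ T, ∀ a, 0 ≤ π0 s a := fun s hs => (hπ0 s hs).1
  have hP0 : ∀ s a s', 0 ≤ P s a s' := fun s a => (hP s a).1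
  have hfin : ∀ s, ∑' l, successWeight T Tp P π0 s l ≠ ⊤ := by
    intro s
    rw [← trajMeasure_pointMass_success]
    refine ne_top_of_le_ne_top ?_ (measure_mono (Set.subset_univ _))
    rw [hterm π0 hπ0 s]
    exact ENNReal.one_ne_top
  have hplus : ∀ s ∉ T, ∀ a, 0 ≤ piPlus T Tp P π0 s a := fun s hs a =>
    div_nonneg (mul_nonneg (hπ s hs a) (Finset.sum_nonneg fun s' _ =>
      mul_nonneg (hP0 s a s') ENNReal.toReal_nonneg)) (hV0 s hs).le
  have hx := xent_eq_sum T Tp P π0 hsub hπ hP0 hfin hV0 μ hμ.1 hdp hplus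
  rw [hx, hx, neg_sub_neg, ← Finset.sum_sub_distrib]
  refine Finset.sum_congr rfl fun s hs => ?_
  have hsT := Finset.mem_compl.mp hs
  rw [← mul_sub, ← Finset.sum_sub_distrib]
  congr 1
  refine Finset.sum_congr rfl fun a _ => ?_
  rcases (hplus s hsT a).eq_or_lt with h | h
  · simp [← h]
  · rw [Real.log_div h.ne' (hsupp s hsT a h).ne', mul_sub]
end
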